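/- Let h* > 0, let A₁₃, A₃₃, A₄₄ be real constants with A₃₃ ≠ 0 and A₄₄ ≠ 0, let p : ℝ² → ℝ be continuously differentiable, let V¹ : ℝ² → ℝ² be twice continuously differentiable, and let 𝔏* be the membrane operator with coefficients ĥ, Ā₁₁, Ā₁₂, Ā₆₆. Define v¹(η, ζ) = −((A₁₃ + A₄₄)/(2 A₃₃ A₄₄)) ζ(1 − ζ) h* ∇p(η) + (1 − ζ) V¹(η). Then the Robin boundary condition A₄₄ (∂v¹/∂ζ)(η, 0) + (1/h*)(𝔏* v¹(·, 0))(η) = −(A₄₄/A₃₃) h* ∇p(η) holds for all η ∈ ℝ² if and only if V¹ satisfies (1/h*)(𝔏* V¹)(η) − A₄₄ V¹(η) = ((A₁₃ − A₄₄)/(2 A₃₃)) h* ∇p(η) for all η ∈ ℝ². -/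

import Mathlib

/-- In-plane partial derivative with respect to the first variable. -/
noncomputable def pd1 (f : ℝ → ℝ → ℝ) (y1 y2 : ℝ) : ℝ :=
  deriv (fun t => f t y2) y1

/-- In-plane partial derivative with respect to the second variable. -/
noncomputable def pd2 (f : ℝ → ℝ → ℝ) (y1 y2 : ℝ) : ℝ :=
  deriv (fun t => f y1 t) y2

/-- First component of the membrane operator `𝔏*` with coefficients
`ĥ, Ā₁₁, Ā₁₂, Ā₆₆`. -/
noncomputable def memL1 (hhat A11b A12b A66b : ℝ) (v1 v2 : ℝ → ℝ → ℝ)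
    (y1 y2 : ℝ) : ℝ :=
  hhat * A11b * pd1 (pd1 v1) y1 y2 + hhat * A66b * pd2 (pd2 v1) y1 y2
    + hhat * (A12b + A66b) * pd1 (pd2 v2) y1 y2

/-- Second component of the membrane operator `𝔏*`. -/
noncomputable def memL2 (hhat A11b A12b A66b : ℝ) (v1 v2 : ℝ → ℝ → ℝ)
    (y1 y2 : ℝ) : ℝ :=
  hhat * A11b * pd2 (pd2 v2) y1 y2 + hhat * A66b * pd1 (pd1 v2) y1 y2
    + hhat * (A12b + A66b) * pd2 (pd1 v1) y1 y2

/-- A component of the first-order tangential displacement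
`v¹(η, ζ) = −((A₁₃+A₄₄)/(2 A₃₃ A₄₄)) ζ(1−ζ) h* (∂p) + (1−ζ) V¹`, where `g` is the
corresponding component of `∇p` and `W` the corresponding component of `V¹`. -/
noncomputable def vcomp (A13 A33 A44 hs : ℝ) (g W : ℝ → ℝ → ℝ)
    (η1 η2 ζ : ℝ) : ℝ :=
  -((A13 + A44) / (2 * A33 * A44)) * (ζ * (1 - ζ)) * hs * g η1 η2
    + (1 - ζ) * W η1 η2

/-- the Robin boundary condition
`A₄₄ ∂v¹/∂ζ|_{ζ=0} + (1/h*) 𝔏* v¹(·,0) = −(A₄₄/A₃₃) h* ∇p` holds for all η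
if and only if `V¹` satisfies `(1/h*) 𝔏* V¹ − A₄₄ V¹ = ((A₁₃−A₄₄)/(2A₃₃)) h* ∇p`. -/
theorem robin_condition_iff_membrane_equation
    (hs : ℝ) (hhs : 0 < hs)
    (A13 A33 A44 : ℝ) (hA33 : A33 ≠ 0) (hA44 : A44 ≠ 0)
    (hhat A11b A12b A66b : ℝ)
    (p : ℝ → ℝ → ℝ) (hp : ContDiff ℝ 1 (fun q : ℝ × ℝ => p q.1 q.2))
    (W1 W2 : ℝ → ℝ → ℝ)
    (hW1 : ContDiff ℝ 2 (fun q : ℝ × ℝ => W1 q.1 q.2))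
    (hW2 : ContDiff ℝ 2 (fun q : ℝ × ℝ => W2 q.1 q.2)) :
    (∀ η1 η2 : ℝ,
        A44 * deriv (fun t => vcomp A13 A33 A44 hs (pd1 p) W1 η1 η2 t) 0
          + (1 / hs) * memL1 hhat A11b A12b A66b
              (fun a b => vcomp A13 A33 A44 hs (pd1 p) W1 a b 0)
              (fun a b => vcomp A13 A33 A44 hs (pd2 p) W2 a b 0) η1 η2
          = -(A44 / A33) * hs * pd1 p η1 η2
      ∧ A44 * deriv (fun t => vcomp A13 A33 A44 hs (pd2 p) W2 η1 η2 t) 0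
          + (1 / hs) * memL2 hhat A11b A12b A66b
              (fun a b => vcomp A13 A33 A44 hs (pd1 p) W1 a b 0)
              (fun a b => vcomp A13 A33 A44 hs (pd2 p) W2 a b 0) η1 η2
          = -(A44 / A33) * hs * pd2 p η1 η2)
    ↔ (∀ η1 η2 : ℝ,
        (1 / hs) * memL1 hhat A11b A12b A66b W1 W2 η1 η2 - A44 * W1 η1 η2
          = ((A13 - A44) / (2 * A33)) * hs * pd1 p η1 η2
      ∧ (1 / hs) * memL2 hhat A11b A12b A66b W1 W2 η1 η2 - A44 * W2 η1 η2
          = ((A13 - A44) / (2 * A33)) * hs * pd2 p η1 η2) := by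
  have h0 : ∀ g W : ℝ → ℝ → ℝ, (fun a b => vcomp A13 A33 A44 hs g W a b 0) = W := by
    intro g W
    funext a b
    simp [vcomp]
  have hd : ∀ (g W : ℝ → ℝ → ℝ) (a b : ℝ),
      A44 * deriv (fun t => vcomp A13 A33 A44 hs g W a b t) 0
        = -((A13 + A44) / (2 * A33)) * hs * g a b - A44 * W a b := by
    intro g W a b
    have h1 : HasDerivAt (fun t : ℝ => 1 - t) (-1) 0 := by
      simpa using (hasDerivAt_id (0 : ℝ)).const_sub 1
    have h2 : HasDerivAt (fun t : ℝ => t * (1 - t)) (1 * (1 - 0) + 0 * (-1)) 0 :=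
      (hasDerivAt_id (0 : ℝ)).mul h1
    have h3 : HasDerivAt (fun t => vcomp A13 A33 A44 hs g W a b t) _ 0 :=
      (((h2.const_mul (-((A13 + A44) / (2 * A33 * A44)))).mul_const hs).mul_const
        (g a b)).add (h1.mul_const (W a b))
    rw [h3.deriv]
    field_simp
    ring
  have key : ∀ L w g : ℝ,
      (-((A13 + A44) / (2 * A33)) * hs * g - A44 * w + L = -(A44 / A33) * hs * g) ↔
      (L - A44 * w = ((A13 - A44) / (2 * A33)) * hs * g) := by
    intro L w g
    have e : ((A13 - A44) / (2 * A33)) * hs * g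
        = -(A44 / A33) * hs * g + ((A13 + A44) / (2 * A33)) * hs * g := by
      field_simp
      ring
    rw [e]
    constructor <;> intro h <;> linarith
  simp only [h0, hd, key]
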